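/- Let G be a connected graph on n ≥ 6 vertices. The largest distance Laplacian eigenvalue of G has multiplicity n - 4 and n is a distance Laplacian eigenvalue of multiplicity 3 if and only if G is isomorphic to one of: K_{n/4,n/4,n/4,n/4} (when 4 | n), K_{(n-1)/3,(n-1)/3,(n-1)/3,1} (when 3 | n-1), K_{(n-2)/2,(n-2)/2,1,1} (when 2 | n-2), or the complete split graph SK_{n,n-3}. -/

import Mathlib

open Matrix

/-- The transmission of a vertex: sum of distances to all other vertices. -/
noncomputable def transmission {V : Type*} [Fintype V] (G : SimpleGraph V) (v : V) : ℕ :=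
  ∑ u, G.dist v u

/-- The distance Laplacian matrix `D^L(G) = Diag(Tr) - D(G)`. -/
noncomputable def distLapMatrix {V : Type*} [Fintype V] [DecidableEq V]
    (G : SimpleGraph V) : Matrix V V ℝ :=
  fun u v => if u = v then (transmission G u : ℝ) else -(G.dist u v : ℝ)

/-- `μ` is an eigenvalue of the real matrix `M`. -/
def IsEigenvalue {V : Type*} [Fintype V] [DecidableEq V] (M : Matrix V V ℝ) (μ : ℝ) : Prop :=
  Module.End.HasEigenvalue (Matrix.toLin' M) μ

/-- The multiplicity of `μ` as an eigenvalue of `M` (dimension of the eigenspace). -/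
noncomputable def eigMult {V : Type*} [Fintype V] [DecidableEq V]
    (M : Matrix V V ℝ) (μ : ℝ) : ℕ :=
  Module.finrank ℝ (Module.End.eigenspace (Matrix.toLin' M) μ)

/-- The complete split graph `SK_{n,α}` on `Fin n` (complement of `K_{n-α} ∪ α·K_1`). -/
def completeSplitGraph (n α : ℕ) : SimpleGraph (Fin n) :=
  SimpleGraph.fromRel (fun u v => α ≤ u.val ∨ α ≤ v.val)

/-- The complete multipartite graph with parts of sizes `t 0, t 1, t 2, t 3`. -/
abbrev K4parts (t : Fin 4 → ℕ) : SimpleGraph (Σ i : Fin 4, Fin (t i)) :=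
  SimpleGraph.completeMultipartiteGraph (fun i => Fin (t i))

/-- If a nonconstant function is constant on nonadjacent pairs, the diameter is at most two. -/
theorem dist_le_two_of_const_on_not_adj {V α : Type*} {G : SimpleGraph V} {x : V → α}
    (h : ∀ u v, ¬ G.Adj u v → x u = x v) {a b : V} (hab : x a ≠ x b) (u v : V) :
    G.dist u v ≤ 2 := by
  by_cases huv : G.Adj u v
  · rw [SimpleGraph.dist_eq_one_iff_adj.mpr huv]; omega
  · obtain ⟨c, hc⟩ : ∃ c, x c ≠ x u := by
      by_contra! hc
      exact hab ((hc a).trans (hc b).symm)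
    have h1 : G.Adj u c := by
      by_contra h1
      exact hc (h _ _ h1).symm
    have h2 : G.Adj c v := by
      by_contra h2
      exact hc ((h _ _ h2).trans (h _ _ huv).symm)
    exact SimpleGraph.dist_le (.cons h1 (.cons h2 .nil))

section DistanceLaplacian

variable {V : Type*} [Fintype V] [DecidableEq V] (G : SimpleGraph V)

theorem distLapMatrix_mulVec_apply (x : V → ℝ) (u : V) :
    (distLapMatrix G *ᵥ x) u = ∑ v, (G.dist u v : ℝ) * (x u - x v) := by
  have h : ∀ v, distLapMatrix G u v * x v =
      (if u = v then (transmission G u : ℝ) * x v else 0) - (G.dist u v : ℝ) * x v := by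
    intro v
    by_cases huv : u = v
    · subst huv; simp [distLapMatrix]
    · simp [distLapMatrix, huv]
  simp only [Matrix.mulVec, dotProduct, h, Finset.sum_sub_distrib, Finset.sum_ite_eq,
    Finset.mem_univ, if_true, transmission, mul_sub, Nat.cast_sum, Finset.sum_mul]

theorem sum_distLapMatrix_mulVec (x : V → ℝ) : ∑ u, (distLapMatrix G *ᵥ x) u = 0 := by
  simp only [distLapMatrix_mulVec_apply, mul_sub, Finset.sum_sub_distrib]
  rw [sub_eq_zero, Finset.sum_comm]
  simp only [G.dist_comm]

variable {G}

theorem sum_eq_zero_of_distLapMatrix_mulVec {x : V → ℝ} {μ : ℝ}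
    (h : distLapMatrix G *ᵥ x = μ • x) (hμ : μ ≠ 0) : ∑ u, x u = 0 := by
  have := sum_distLapMatrix_mulVec G x
  rw [h] at this
  simp only [Pi.smul_apply, smul_eq_mul, ← Finset.mul_sum] at this
  exact (mul_eq_zero.mp this).resolve_left hμ

/-- An eigenvector for the order of the graph is constant on nonadjacent pairs. -/
theorem eq_of_not_adj_of_distLapMatrix_mulVec (hG : G.Connected) {x : V → ℝ}
    (h : distLapMatrix G *ᵥ x = (Fintype.card V : ℝ) • x) {u v : V} (huv : ¬ G.Adj u v) :
    x u = x v := by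
  by_cases huv' : u = v
  · rw [huv']
  have hne : Nonempty V := ⟨u⟩
  have hs := sum_eq_zero_of_distLapMatrix_mulVec h (by simp)
  have hrow : ∀ a, ∑ b, ((G.dist a b : ℝ) - 1) * (x a - x b) = 0 := by
    intro a
    have := congrFun h a
    rw [distLapMatrix_mulVec_apply] at this
    simp only [sub_mul, one_mul, Finset.sum_sub_distrib, this, hs]
    simp
  have hquad : ∑ a, ∑ b, ((G.dist a b : ℝ) - 1) * (x a - x b) ^ 2 = 0 := by
    have h1 : ∑ a, ∑ b, ((G.dist a b : ℝ) - 1) * (x a - x b) * x a = 0 := by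
      simp only [← Finset.sum_mul, hrow, zero_mul, Finset.sum_const_zero]
    have h2 : ∑ a, ∑ b, ((G.dist a b : ℝ) - 1) * (x b - x a) * x b = 0 := by
      rw [Finset.sum_comm]
      simpa only [G.dist_comm] using h1
    rw [← add_zero (0 : ℝ)]
    nth_rewrite 1 [← h1]
    rw [← h2]
    simp only [← Finset.sum_add_distrib]
    exact Finset.sum_congr rfl fun a _ => Finset.sum_congr rfl fun b _ => by ring
  have hnonneg : ∀ a b, 0 ≤ ((G.dist a b : ℝ) - 1) * (x a - x b) ^ 2 := by
    intro a b
    by_cases hab : a = b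
    · simp [hab]
    · have : 1 ≤ G.dist a b := hG.pos_dist_of_ne hab
      have : (1 : ℝ) ≤ G.dist a b := by exact_mod_cast this
      exact mul_nonneg (by linarith) (sq_nonneg _)
  rw [Finset.sum_eq_zero_iff_of_nonneg fun a _ => Finset.sum_nonneg fun b _ => hnonneg a b] at hquad
  have := hquad u (Finset.mem_univ u)
  rw [Finset.sum_eq_zero_iff_of_nonneg fun b _ => hnonneg u b] at this
  have := this v (Finset.mem_univ v)
  have h1 : 1 ≤ G.dist u v := hG.pos_dist_of_ne huv'
  have h2 : G.dist u v ≠ 1 := fun hd => huv (SimpleGraph.dist_eq_one_iff_adj.mp hd)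
  have h3 : (2 : ℝ) ≤ G.dist u v := by exact_mod_cast (by omega : 2 ≤ G.dist u v)
  rcases mul_eq_zero.mp this with h | h
  · linarith
  · exact sub_eq_zero.mp (pow_eq_zero_iff two_ne_zero |>.mp h)

variable [DecidableRel G.Adj]

theorem distLapMatrix_mulVec_of_dist_le_two (hG : G.Connected) (hd : ∀ u v, G.dist u v ≤ 2)
    (x : V → ℝ) :
    distLapMatrix G *ᵥ x =
      fun u => (Fintype.card V : ℝ) * x u - ∑ v, x v + (Gᶜ.lapMatrix ℝ *ᵥ x) u := by
  ext u
  rw [distLapMatrix_mulVec_apply, SimpleGraph.lapMatrix_mulVec_apply]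
  have h : ∀ v, (G.dist u v : ℝ) * (x u - x v) =
      (x u - x v) + if v ∈ Gᶜ.neighborFinset u then x u - x v else 0 := by
    intro v
    by_cases huv : u = v
    · simp [huv]
    · by_cases hadj : G.Adj u v
      · simp [SimpleGraph.dist_eq_one_iff_adj.mpr hadj, hadj]
      · have h1 : 1 ≤ G.dist u v := hG.pos_dist_of_ne huv
        have h2 : G.dist u v ≠ 1 := fun hd => hadj (SimpleGraph.dist_eq_one_iff_adj.mp hd)
        have h3 : G.dist u v = 2 := le_antisymm (hd u v) (by omega)
        simp [h3, hadj, huv]; ring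
  simp only [h, Finset.sum_add_distrib, Finset.sum_ite_mem, Finset.univ_inter,
    Finset.sum_sub_distrib, Finset.sum_const, nsmul_eq_mul, Finset.card_univ,
    SimpleGraph.card_neighborFinset_eq_degree]

theorem sum_lapMatrix_mulVec (H : SimpleGraph V) [DecidableRel H.Adj] (x : V → ℝ) :
    ∑ u, (H.lapMatrix ℝ *ᵥ x) u = 0 := by
  have h : (1 : V → ℝ) ⬝ᵥ (H.lapMatrix ℝ *ᵥ x) = 0 := by
    rw [Matrix.dotProduct_mulVec, ← Matrix.mulVec_transpose, (H.isSymm_lapMatrix ℝ).eq]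
    rw [show (1 : V → ℝ) = fun _ => 1 from rfl, H.lapMatrix_mulVec_const_eq_zero]
    simp
  simpa [dotProduct] using h

theorem mem_eigenspace_distLapMatrix_iff (hG : G.Connected) (hd : ∀ u v, G.dist u v ≤ 2)
    {μ : ℝ} (hμ : μ ≠ 0) (x : V → ℝ) :
    distLapMatrix G *ᵥ x = μ • x ↔
      ∑ v, x v = 0 ∧ Gᶜ.lapMatrix ℝ *ᵥ x = (μ - Fintype.card V) • x := by
  constructor
  · intro h
    have hs := sum_eq_zero_of_distLapMatrix_mulVec h hμ
    refine ⟨hs, ?_⟩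
    rw [distLapMatrix_mulVec_of_dist_le_two hG hd, hs] at h
    ext u
    have := congrFun h u
    simp only [Pi.smul_apply, smul_eq_mul] at this ⊢
    linarith
  · rintro ⟨hs, h⟩
    rw [distLapMatrix_mulVec_of_dist_le_two hG hd, hs, h]
    ext u
    simp only [Pi.smul_apply, smul_eq_mul]
    ring

theorem eigenspace_distLapMatrix (hG : G.Connected) (hd : ∀ u v, G.dist u v ≤ 2)
    {μ : ℝ} (hμ : μ ≠ 0) (hμ' : μ ≠ Fintype.card V) :
    Module.End.eigenspace (Matrix.toLin' (distLapMatrix G)) μ =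
      Module.End.eigenspace (Matrix.toLin' (Gᶜ.lapMatrix ℝ)) (μ - Fintype.card V) := by
  ext x
  rw [Module.End.mem_eigenspace_iff, Module.End.mem_eigenspace_iff, Matrix.toLin'_apply,
    Matrix.toLin'_apply, mem_eigenspace_distLapMatrix_iff hG hd hμ]
  refine ⟨And.right, fun h => ⟨?_, h⟩⟩
  have := sum_lapMatrix_mulVec Gᶜ x
  rw [h] at this
  simp only [Pi.smul_apply, smul_eq_mul, ← Finset.mul_sum] at this
  exact (mul_eq_zero.mp this).resolve_left (sub_ne_zero.mpr hμ')

theorem finrank_ker_lapMatrix_compl [Nonempty V] (hG : G.Connected)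
    (hd : ∀ u v, G.dist u v ≤ 2) :
    Module.finrank ℝ (LinearMap.ker (Matrix.toLin' (Gᶜ.lapMatrix ℝ))) =
      eigMult (distLapMatrix G) (Fintype.card V) + 1 := by
  have hcard : (Fintype.card V : ℝ) ≠ 0 := by simp
  let K := LinearMap.ker (Matrix.toLin' (Gᶜ.lapMatrix ℝ))
  let s : (V → ℝ) →ₗ[ℝ] ℝ := ∑ v, LinearMap.proj v
  have hs : ∀ x, s x = ∑ v, x v := fun x => by simp [s]
  have hone : (fun _ => 1 : V → ℝ) ∈ K := by
    rw [LinearMap.mem_ker, Matrix.toLin'_apply, SimpleGraph.lapMatrix_mulVec_const_eq_zero]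
  have hsurj : Function.Surjective (s.domRestrict K) := by
    refine LinearMap.surjective fun h => ?_
    have := LinearMap.congr_fun h ⟨_, hone⟩
    rw [LinearMap.domRestrict_apply, hs] at this
    simp at this
  have hrank := LinearMap.finrank_range_add_finrank_ker (s.domRestrict K)
  rw [LinearMap.range_eq_top.mpr hsurj, finrank_top, Module.finrank_self] at hrank
  have hE : Submodule.map K.subtype (LinearMap.ker (s.domRestrict K)) =
      Module.End.eigenspace (Matrix.toLin' (distLapMatrix G)) (Fintype.card V : ℝ) := by
    ext x
    rw [Module.End.mem_eigenspace_iff, Matrix.toLin'_apply,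
      mem_eigenspace_distLapMatrix_iff hG hd hcard, sub_self, zero_smul, Submodule.mem_map]
    constructor
    · rintro ⟨y, hy, rfl⟩
      rw [LinearMap.mem_ker, LinearMap.domRestrict_apply, hs] at hy
      exact ⟨hy, LinearMap.mem_ker.mp y.2⟩
    · rintro ⟨h1, h2⟩
      exact ⟨⟨x, LinearMap.mem_ker.mpr h2⟩, by
        rw [LinearMap.mem_ker, LinearMap.domRestrict_apply, hs]; exact h1, rfl⟩
  rw [eigMult, ← hE, Submodule.finrank_map_subtype_eq, ← hrank, add_comm]

theorem isEigenvalue_of_mulVec {M : Matrix V V ℝ} {x : V → ℝ} {μ : ℝ} (hx : x ≠ 0)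
    (h : M *ᵥ x = μ • x) : IsEigenvalue M μ :=
  Module.End.hasEigenvalue_of_hasEigenvector
    (Module.End.hasEigenvector_iff.mpr ⟨Module.End.mem_eigenspace_iff.mpr (by simpa using h), hx⟩)

theorem IsEigenvalue.exists_mulVec {M : Matrix V V ℝ} {μ : ℝ} (h : IsEigenvalue M μ) :
    ∃ x : V → ℝ, x ≠ 0 ∧ M *ᵥ x = μ • x := by
  obtain ⟨x, hx⟩ := Module.End.HasEigenvalue.exists_hasEigenvector h
  exact ⟨x, hx.2, by simpa using hx.apply_eq_smul⟩

theorem isEigenvalue_of_eigMult_ne_zero {M : Matrix V V ℝ} {μ : ℝ} (h : eigMult M μ ≠ 0) :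
    IsEigenvalue M μ := by
  intro hbot
  refine h ?_
  rw [eigMult, Module.End.eigenspace, hbot, finrank_bot]

theorem eigenspace_le_range {E : Type*} [AddCommGroup E] [Module ℝ E]
    (T : Module.End ℝ E) {l : ℝ} (hl : l ≠ 0) :
    Module.End.eigenspace T l ≤ LinearMap.range T := by
  intro x hx
  rw [Module.End.mem_eigenspace_iff] at hx
  exact ⟨l⁻¹ • x, by rw [map_smul, hx, smul_smul, inv_mul_cancel₀ hl, one_smul]⟩

theorem range_eq_eigenspace_iff {E : Type*} [AddCommGroup E] [Module ℝ E]
    (T : Module.End ℝ E) {l : ℝ} (hl : l ≠ 0) :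
    LinearMap.range T = Module.End.eigenspace T l ↔ ∀ x, T (T x) = l • T x := by
  constructor
  · intro h x
    rw [← Module.End.mem_eigenspace_iff, ← h]
    exact LinearMap.mem_range_self T x
  · intro h
    apply le_antisymm
    · rintro _ ⟨x, rfl⟩
      exact Module.End.mem_eigenspace_iff.mpr (h x)
    · exact eigenspace_le_range T hl

theorem exists_pos_eigenvalue_lapMatrix (H : SimpleGraph V) [DecidableRel H.Adj]
    (h : H.lapMatrix ℝ ≠ 0) : ∃ ν : ℝ, 0 < ν ∧ ∃ x : V → ℝ, x ≠ 0 ∧ H.lapMatrix ℝ *ᵥ x = ν • x := by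
  have hps := H.posSemidef_lapMatrix ℝ
  have hne : hps.isHermitian.eigenvalues ≠ 0 := fun h0 =>
    h (hps.isHermitian.eigenvalues_eq_zero_iff.mp h0)
  obtain ⟨i, hi⟩ := Function.ne_iff.mp hne
  refine ⟨_, lt_of_le_of_ne (hps.eigenvalues_nonneg i) (Ne.symm hi), _, ?_,
    hps.isHermitian.mulVec_eigenvectorBasis i⟩
  intro h0
  exact hps.isHermitian.eigenvectorBasis.orthonormal.ne_zero i (by ext j; exact congrFun h0 j)

/-- For diameter at most two, the multiplicity condition on the distance Laplacian is a condition
on the Laplacian of the complement. -/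
theorem distLapMatrix_multiplicities_iff {n : ℕ} (hn : 6 ≤ n) (hV : Fintype.card V = n)
    (hG : G.Connected) (hd : ∀ u v, G.dist u v ≤ 2) :
    ((∃ μ : ℝ, IsEigenvalue (distLapMatrix G) μ ∧
        (∀ ν : ℝ, IsEigenvalue (distLapMatrix G) ν → ν ≤ μ) ∧
        eigMult (distLapMatrix G) μ = n - 4) ∧ eigMult (distLapMatrix G) (n : ℝ) = 3) ↔
      Module.finrank ℝ (LinearMap.ker (Matrix.toLin' (Gᶜ.lapMatrix ℝ))) = 4 ∧
        ∃ l : ℝ, 0 < l ∧ ∀ x : V → ℝ,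
          Gᶜ.lapMatrix ℝ *ᵥ (Gᶜ.lapMatrix ℝ *ᵥ x) = l • (Gᶜ.lapMatrix ℝ *ᵥ x) := by
  have : Nonempty V := Fintype.card_pos_iff.mp (by omega)
  have hn0 : (0 : ℝ) < n := by exact_mod_cast (by omega : 0 < n)
  have hker := finrank_ker_lapMatrix_compl hG hd
  rw [hV] at hker
  have hrank := LinearMap.finrank_range_add_finrank_ker (Matrix.toLin' (Gᶜ.lapMatrix ℝ))
  rw [Module.finrank_fintype_fun_eq_card, hV] at hrank
  constructor
  · rintro ⟨⟨μ, -, hmax, hmult⟩, h3⟩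
    rw [h3] at hker
    refine ⟨hker, μ - n, ?_⟩
    have hL : Gᶜ.lapMatrix ℝ ≠ 0 := by
      intro h0
      rw [h0, map_zero, LinearMap.range_zero, finrank_bot] at hrank
      rw [h0, map_zero] at hker
      omega
    obtain ⟨ν, hν, x, hx, hLx⟩ := exists_pos_eigenvalue_lapMatrix Gᶜ hL
    have hsum : ∑ v, x v = 0 := by
      have := sum_lapMatrix_mulVec Gᶜ x
      rw [hLx] at this
      simp only [Pi.smul_apply, smul_eq_mul, ← Finset.mul_sum] at this
      exact (mul_eq_zero.mp this).resolve_left hν.ne'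
    have hle := hmax (n + ν) (isEigenvalue_of_mulVec hx
      ((mem_eigenspace_distLapMatrix_iff hG hd (by positivity) x).mpr
        ⟨hsum, by rw [hLx, hV]; congr 1; ring⟩))
    have hpos : 0 < μ - n := by linarith
    refine ⟨hpos, ?_⟩
    rw [eigMult, eigenspace_distLapMatrix hG hd (by linarith) (by rw [hV]; linarith), hV] at hmult
    have heq := Submodule.eq_of_le_of_finrank_eq
      (eigenspace_le_range (Matrix.toLin' (Gᶜ.lapMatrix ℝ)) hpos.ne') (by omega)
    exact (range_eq_eigenspace_iff _ hpos.ne').mp heq.symm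
  · rintro ⟨h4, l, hl, hLL⟩
    have hmult : eigMult (distLapMatrix G) (n + l) = n - 4 := by
      rw [eigMult, eigenspace_distLapMatrix hG hd (by positivity) (by rw [hV]; linarith), hV,
        add_sub_cancel_left, ← (range_eq_eigenspace_iff _ hl.ne').mpr hLL]
      omega
    refine ⟨⟨n + l, isEigenvalue_of_eigMult_ne_zero (by omega), fun ν hν => ?_, hmult⟩, by omega⟩
    obtain ⟨x, hx, hMx⟩ := hν.exists_mulVec
    by_contra! hlt
    have hν0 : ν ≠ 0 := by linarith
    obtain ⟨-, hLx⟩ := (mem_eigenspace_distLapMatrix_iff hG hd hν0 x).mp hMx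
    have h := hLL x
    rw [hLx, Matrix.mulVec_smul, hLx, smul_smul, smul_smul, hV] at h
    have := smul_left_injective ℝ hx h
    have h2 : (ν - n - l) * (ν - n) = 0 := by linear_combination this
    have h3 : 0 < ν - n - l := by linarith
    have h4 : 0 < ν - n := by linarith
    exact (mul_pos h3 h4).ne' h2

end DistanceLaplacian

section UnionOfCliques

variable {V : Type*} [Fintype V] [DecidableEq V] {H : SimpleGraph V} [DecidableRel H.Adj]

theorem lapMatrix_mulVec_single_apply (H : SimpleGraph V) [DecidableRel H.Adj] (u w : V) :
    (H.lapMatrix ℝ *ᵥ Pi.single w 1) u =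
      (if u = w then (H.degree u : ℝ) else 0) - if H.Adj u w then 1 else 0 := by
  rw [SimpleGraph.lapMatrix_mulVec_apply]
  simp [Pi.single_apply]

theorem adj_trans_of_lapMatrix_sq {l : ℝ}
    (h : ∀ x : V → ℝ, H.lapMatrix ℝ *ᵥ (H.lapMatrix ℝ *ᵥ x) = l • (H.lapMatrix ℝ *ᵥ x))
    {u v w : V} (huv : H.Adj u v) (hvw : H.Adj v w) (huw : u ≠ w) : H.Adj u w := by
  by_contra hadj
  have := congrFun (h (Pi.single w 1)) u
  rw [SimpleGraph.lapMatrix_mulVec_apply, Pi.smul_apply, lapMatrix_mulVec_single_apply,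
    if_neg huw, if_neg hadj, sub_zero, mul_zero, smul_zero, zero_sub, neg_eq_zero] at this
  have hterm : ∀ b ∈ H.neighborFinset u,
      (H.lapMatrix ℝ *ᵥ Pi.single w 1) b = -if H.Adj b w then 1 else 0 := by
    intro b hb
    rw [lapMatrix_mulVec_single_apply, if_neg, zero_sub]
    rintro rfl
    exact hadj (by simpa using hb)
  rw [Finset.sum_congr rfl hterm, Finset.sum_neg_distrib, neg_eq_zero,
    Finset.sum_eq_zero_iff_of_nonneg (fun b _ => by split_ifs <;> norm_num)] at this
  simpa [hvw] using this v (by simpa using huv)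

theorem degree_eq_of_lapMatrix_sq {l : ℝ}
    (h : ∀ x : V → ℝ, H.lapMatrix ℝ *ᵥ (H.lapMatrix ℝ *ᵥ x) = l • (H.lapMatrix ℝ *ᵥ x))
    {u : V} (hu : H.degree u ≠ 0) : (H.degree u : ℝ) + 1 = l := by
  have := congrFun (h (Pi.single u 1)) u
  rw [SimpleGraph.lapMatrix_mulVec_apply, Pi.smul_apply, lapMatrix_mulVec_single_apply] at this
  have hterm : ∀ b ∈ H.neighborFinset u,
      (H.lapMatrix ℝ *ᵥ Pi.single u 1) b = -1 := by
    intro b hb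
    have hb' : H.Adj u b := by simpa using hb
    rw [lapMatrix_mulVec_single_apply, if_neg hb'.ne', if_pos hb'.symm, zero_sub]
  rw [Finset.sum_congr rfl hterm] at this
  simp at this
  have hu' : (H.degree u : ℝ) ≠ 0 := by exact_mod_cast hu
  apply mul_right_cancel₀ hu'
  linear_combination this

theorem finrank_ker_lapMatrix_of_adj_iff {α : Type*} [Fintype α] {f : V → α}
    (hf : ∀ u v, H.Adj u v ↔ u ≠ v ∧ f u = f v) (hsurj : Function.Surjective f) :
    Module.finrank ℝ (LinearMap.ker (Matrix.toLin' (H.lapMatrix ℝ))) = Fintype.card α := by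
  classical
  have hreach : ∀ u v, H.Reachable u v → f u = f v := by
    rintro u v ⟨p⟩
    induction p with
    | nil => rfl
    | cons hadj _ ih => exact ((hf _ _).mp hadj).2.trans ih
  have hbij : Function.Bijective
      (Quot.lift f hreach : H.ConnectedComponent → α) := by
    constructor
    · rintro ⟨u⟩ ⟨v⟩ (huv : f u = f v)
      by_cases h : u = v
      · rw [h]
      · exact Quot.sound ((hf u v).mpr ⟨h, huv⟩).reachable
    · intro a
      obtain ⟨u, hu⟩ := hsurj a
      exact ⟨H.connectedComponentMk u, hu⟩
  rw [← SimpleGraph.card_connectedComponent_eq_finrank_ker_toLin'_lapMatrix]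
  exact Fintype.card_of_bijective hbij

variable {α : Type*} [DecidableEq α] {f : V → α}

theorem neighborFinset_of_adj_iff (hf : ∀ u v, H.Adj u v ↔ u ≠ v ∧ f u = f v) (u : V) :
    H.neighborFinset u = (Finset.univ.filter fun v => f v = f u).erase u := by
  ext v
  simp [hf, eq_comm]

theorem degree_add_one_of_adj_iff (hf : ∀ u v, H.Adj u v ↔ u ≠ v ∧ f u = f v) (u : V) :
    H.degree u + 1 = (Finset.univ.filter fun v => f v = f u).card := by
  rw [← SimpleGraph.card_neighborFinset_eq_degree, neighborFinset_of_adj_iff hf,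
    Finset.card_erase_add_one (by simp)]

theorem lapMatrix_mulVec_of_adj_iff (hf : ∀ u v, H.Adj u v ↔ u ≠ v ∧ f u = f v) (x : V → ℝ)
    (u : V) : (H.lapMatrix ℝ *ᵥ x) u =
      (Finset.univ.filter fun v => f v = f u).card * x u
        - ∑ v ∈ Finset.univ.filter fun v => f v = f u, x v := by
  rw [SimpleGraph.lapMatrix_mulVec_apply, ← degree_add_one_of_adj_iff hf,
    neighborFinset_of_adj_iff hf, ← Finset.add_sum_erase (Finset.univ.filter fun v => f v = f u) x
      (a := u) (by simp)]
  push_cast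
  ring

theorem lapMatrix_sq_of_adj_iff (hf : ∀ u v, H.Adj u v ↔ u ≠ v ∧ f u = f v) {k : ℕ}
    (hk : ∀ i, (Finset.univ.filter fun v => f v = i).card = 1 ∨
      (Finset.univ.filter fun v => f v = i).card = k) (x : V → ℝ) :
    H.lapMatrix ℝ *ᵥ (H.lapMatrix ℝ *ᵥ x) = (k : ℝ) • (H.lapMatrix ℝ *ᵥ x) := by
  ext u
  rw [lapMatrix_mulVec_of_adj_iff hf, Pi.smul_apply, smul_eq_mul]
  have hsum : ∑ v ∈ Finset.univ.filter fun v => f v = f u, (H.lapMatrix ℝ *ᵥ x) v = 0 := by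
    have hterm : ∀ v ∈ Finset.univ.filter fun v => f v = f u, (H.lapMatrix ℝ *ᵥ x) v =
        (Finset.univ.filter fun v => f v = f u).card * x v
          - ∑ v ∈ Finset.univ.filter fun v => f v = f u, x v := by
      intro v hv
      rw [lapMatrix_mulVec_of_adj_iff hf, (Finset.mem_filter.mp hv).2]
    rw [Finset.sum_congr rfl hterm, Finset.sum_sub_distrib, ← Finset.mul_sum, Finset.sum_const,
      nsmul_eq_mul, sub_self]
  rw [hsum, sub_zero]
  rcases hk (f u) with h | h
  · obtain ⟨a, ha⟩ := Finset.card_eq_one.mp h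
    have hau : u = a := by
      have : u ∈ Finset.univ.filter fun v => f v = f u := by simp
      simpa [ha] using this
    rw [lapMatrix_mulVec_of_adj_iff hf, ha, ← hau]
    simp
  · rw [h]

/-- The Laplacian has a four-dimensional kernel and a single nonzero eigenvalue exactly for
disjoint unions of four cliques, each of which is a vertex or of one common size. -/
theorem lapMatrix_two_eigenvalues_iff (hV : 6 ≤ Fintype.card V) :
    (Module.finrank ℝ (LinearMap.ker (Matrix.toLin' (H.lapMatrix ℝ))) = 4 ∧
        ∃ l : ℝ, 0 < l ∧ ∀ x : V → ℝ,
          H.lapMatrix ℝ *ᵥ (H.lapMatrix ℝ *ᵥ x) = l • (H.lapMatrix ℝ *ᵥ x)) ↔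
      ∃ (f : V → Fin 4) (k : ℕ), 2 ≤ k ∧ (∀ u v, H.Adj u v ↔ u ≠ v ∧ f u = f v) ∧
        ∀ i, (Finset.univ.filter fun v => f v = i).card = 1 ∨
          (Finset.univ.filter fun v => f v = i).card = k := by
  classical
  constructor
  · rintro ⟨hker, l, -, hl⟩
    rw [← SimpleGraph.card_connectedComponent_eq_finrank_ker_toLin'_lapMatrix] at hker
    let e : H.ConnectedComponent ≃ Fin 4 := Fintype.equivFinOfCardEq hker
    let f : V → Fin 4 := fun v => e (H.connectedComponentMk v)
    have hreach : ∀ u v, H.Reachable u v → u = v ∨ H.Adj u v := by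
      rintro u v ⟨p⟩
      induction p with
      | nil => exact .inl rfl
      | @cons a b c hadj _ ih =>
        by_cases hac : a = c
        · exact .inl hac
        · rcases ih with rfl | ih
          · exact .inr hadj
          · exact .inr (adj_trans_of_lapMatrix_sq hl hadj ih hac)
    have hf : ∀ u v, H.Adj u v ↔ u ≠ v ∧ f u = f v := by
      intro u v
      simp only [f, EmbeddingLike.apply_eq_iff_eq, SimpleGraph.ConnectedComponent.eq]
      exact ⟨fun h => ⟨h.ne, h.reachable⟩, fun ⟨h1, h2⟩ => (hreach u v h2).resolve_left h1⟩
    have hsurj : Function.Surjective f := by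
      intro i
      obtain ⟨v, hv⟩ := Quot.exists_rep (e.symm i)
      exact ⟨v, e.symm_apply_eq.mp hv.symm |>.symm⟩
    have hdeg := degree_add_one_of_adj_iff hf
    obtain ⟨w, hw⟩ : ∃ w, H.degree w ≠ 0 := by
      by_contra! hdeg0
      have hcard := Finset.card_eq_sum_card_fiberwise (f := f) (s := Finset.univ)
        (t := Finset.univ) (by simp)
      have hone : ∀ i, (Finset.univ.filter fun v => f v = i).card = 1 := by
        intro i
        obtain ⟨u, rfl⟩ := hsurj i
        rw [← hdeg, hdeg0]
      simp only [hone, Finset.card_univ, Finset.sum_const, Fintype.card_fin,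
        smul_eq_mul] at hcard
      omega
    refine ⟨f, H.degree w + 1, by omega, hf, fun i => ?_⟩
    obtain ⟨u, rfl⟩ := hsurj i
    rw [← hdeg]
    by_cases hu : H.degree u = 0
    · left; omega
    · right
      have h1 := degree_eq_of_lapMatrix_sq hl hu
      rw [← degree_eq_of_lapMatrix_sq hl hw] at h1
      exact_mod_cast h1
  · rintro ⟨f, k, hk, hf, hfib⟩
    have hsurj : Function.Surjective f := by
      intro i
      have : 0 < (Finset.univ.filter fun v => f v = i).card := by
        rcases hfib i with h | h <;> omega
      obtain ⟨v, hv⟩ := Finset.card_pos.mp this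
      exact ⟨v, (Finset.mem_filter.mp hv).2⟩
    exact ⟨finrank_ker_lapMatrix_of_adj_iff hf hsurj, k, by exact_mod_cast (by omega : 0 < k),
      lapMatrix_sq_of_adj_iff hf hfib⟩

end UnionOfCliques

section CompleteMultipartite

/-- A partition of the vertices into four independent sets of prescribed sizes, with all edges
between different parts. -/
def HasMultipartition {V : Type*} [Fintype V] (G : SimpleGraph V) (t : Fin 4 → ℕ) : Prop :=
  ∃ f : V → Fin 4, (∀ u v, G.Adj u v ↔ f u ≠ f v) ∧
    ∀ i, (Finset.univ.filter fun v => f v = i).card = t i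

variable {V W : Type*} [Fintype V] [Fintype W] {G : SimpleGraph V} {G' : SimpleGraph W}
  {t : Fin 4 → ℕ}

theorem HasMultipartition.of_iso (e : G ≃g G') (h : HasMultipartition G' t) :
    HasMultipartition G t := by
  obtain ⟨f, hf, hcard⟩ := h
  refine ⟨f ∘ e, fun u v => by rw [← e.map_adj_iff, hf]; rfl, fun i => ?_⟩
  rw [← hcard i]
  exact Finset.card_bij (fun v _ => e v) (by simp) (by simp)
    (fun w hw => ⟨e.symm w, by simpa using hw, by simp⟩)

theorem hasMultipartition_K4parts (t : Fin 4 → ℕ) : HasMultipartition (K4parts t) t := by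
  refine ⟨Sigma.fst, fun u v => Iff.rfl, fun i => ?_⟩
  rw [← Fintype.card_subtype, Fintype.card_congr (Equiv.sigmaSubtype i), Fintype.card_fin]

theorem HasMultipartition.nonempty_iso (h : HasMultipartition G t)
    (h' : HasMultipartition G' t) : Nonempty (G ≃g G') := by
  classical
  obtain ⟨f, hf, hcard⟩ := h
  obtain ⟨g, hg, hcard'⟩ := h'
  have e : ∀ i, {v // f v = i} ≃ {w // g w = i} := fun i => Fintype.equivOfCardEq (by
    rw [Fintype.card_subtype, Fintype.card_subtype, hcard, hcard'])
  let E : V ≃ W := (Equiv.sigmaFiberEquiv f).symm.trans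
    ((Equiv.sigmaCongrRight e).trans (Equiv.sigmaFiberEquiv g))
  have hE : ∀ v, g (E v) = f v := fun v => (e (f v) ⟨v, rfl⟩).2
  exact ⟨⟨E, by intro u v; rw [hg, hf, hE, hE]⟩⟩

theorem hasMultipartition_completeSplitGraph {n : ℕ} (hn : 3 ≤ n) :
    HasMultipartition (completeSplitGraph n (n - 3)) ![n - 3, 1, 1, 1] := by
  have h1 : ∀ v : Fin n, v.val + 1 - (n - 3) < 4 := fun v => by omega
  refine ⟨fun v => ⟨v.val + 1 - (n - 3), h1 v⟩, fun u v => ?_, fun i => ?_⟩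
  · simp only [completeSplitGraph, SimpleGraph.fromRel_adj, ne_eq, Fin.ext_iff]
    omega
  · have hsplit : ∀ j : ℕ, 1 ≤ j → (hj : j < 4) → (Finset.univ.filter fun v : Fin n =>
        (⟨v.val + 1 - (n - 3), h1 v⟩ : Fin 4) = ⟨j, hj⟩).card = 1 := by
      intro j hj1 hj
      rw [Finset.card_eq_one]
      refine ⟨⟨n - 3 + j - 1, by omega⟩, ?_⟩
      ext v
      simp only [Finset.mem_filter, Finset.mem_univ, true_and, Fin.ext_iff,
        Finset.mem_singleton]
      omega
    fin_cases i
    · have : (Finset.univ.filter fun v : Fin n =>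
          (⟨v.val + 1 - (n - 3), h1 v⟩ : Fin 4) = 0) =
          Finset.univ.filter fun v : Fin n => v.val < n - 3 := by
        ext v
        simp [Fin.ext_iff]
        omega
      exact this ▸ (Fin.card_filter_val_lt ..).trans (min_eq_right (Nat.sub_le n 3))
    · exact hsplit 1 (by norm_num) (by norm_num)
    · exact hsplit 2 (by norm_num) (by norm_num)
    · exact hsplit 3 (by norm_num) (by norm_num)

/-- The parts can be reordered decreasingly. -/
theorem HasMultipartition.exists_antitone (h : HasMultipartition G t) :
    ∃ σ : Equiv.Perm (Fin 4), Antitone (t ∘ σ) ∧ HasMultipartition G (t ∘ σ) := by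
  have hmono := Tuple.monotone_sort (OrderDual.toDual ∘ t)
  refine ⟨Tuple.sort (OrderDual.toDual ∘ t), fun i j hij => hmono hij, ?_⟩
  obtain ⟨f, hf, hcard⟩ := h
  refine ⟨(Tuple.sort (OrderDual.toDual ∘ t)).symm ∘ f, fun u v => by simp [hf], fun i => ?_⟩
  simp only [Function.comp_apply, ← hcard, Equiv.symm_apply_eq]

theorem HasMultipartition.sum_eq (h : HasMultipartition G t) :
    t 0 + t 1 + t 2 + t 3 = Fintype.card V := by
  obtain ⟨f, -, hcard⟩ := h
  have := Finset.card_eq_sum_card_fiberwise (f := f) (s := Finset.univ)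
        (t := Finset.univ) (by simp)
  rw [← Finset.card_univ, this, Fin.sum_univ_four]
  simp only [hcard]

theorem distLapMatrix_multiplicities_iff_hasMultipartition [DecidableEq V] {n : ℕ} (hn : 6 ≤ n)
    (hV : Fintype.card V = n) (hG : G.Connected) :
    ((∃ μ : ℝ, IsEigenvalue (distLapMatrix G) μ ∧
        (∀ ν : ℝ, IsEigenvalue (distLapMatrix G) ν → ν ≤ μ) ∧
        eigMult (distLapMatrix G) μ = n - 4) ∧ eigMult (distLapMatrix G) (n : ℝ) = 3) ↔
      ∃ (t : Fin 4 → ℕ) (k : ℕ), 2 ≤ k ∧ (∀ i, t i = 1 ∨ t i = k) ∧ HasMultipartition G t := by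
  classical
  have hcompl : ∀ f : V → Fin 4, (∀ u v, Gᶜ.Adj u v ↔ u ≠ v ∧ f u = f v) ↔
      ∀ u v, G.Adj u v ↔ f u ≠ f v := by
    intro f
    refine forall_congr' fun u => forall_congr' fun v => ?_
    rw [SimpleGraph.compl_adj]
    by_cases huv : u = v
    · simp [huv]
    · simp only [ne_eq, huv, not_false_eq_true, true_and]
      tauto
  constructor
  · intro h
    have hd : ∀ u v, G.dist u v ≤ 2 := by
      obtain ⟨x, hx, hMx⟩ := (isEigenvalue_of_eigMult_ne_zero
        (M := distLapMatrix G) (μ := n) (by rw [h.2]; norm_num)).exists_mulVec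
      have hs := sum_eq_zero_of_distLapMatrix_mulVec hMx (by
        exact_mod_cast (by omega : n ≠ 0))
      obtain ⟨a, b, hab⟩ : ∃ a b, x a ≠ x b := by
        by_contra! hconst
        apply hx
        ext a
        simp only [fun b => hconst b a, Finset.sum_const, Finset.card_univ, hV,
          nsmul_eq_mul] at hs
        exact (mul_eq_zero.mp hs).resolve_left (by exact_mod_cast (by omega : n ≠ 0))
      rw [← hV] at hMx
      exact dist_le_two_of_const_on_not_adj
        (fun u v huv => eq_of_not_adj_of_distLapMatrix_mulVec hG hMx huv) hab
    obtain ⟨f, k, hk, hf, hfib⟩ := (lapMatrix_two_eigenvalues_iff (by omega)).mp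
      ((distLapMatrix_multiplicities_iff hn hV hG hd).mp h)
    exact ⟨_, k, hk, hfib, f, (hcompl f).mp hf, fun i => rfl⟩
  · rintro ⟨t, k, hk, ht, f, hf, hcard⟩
    have hsurj : Function.Surjective f := by
      intro i
      have : 0 < (Finset.univ.filter fun v => f v = i).card := by
        rw [hcard]
        rcases ht i with h | h <;> omega
      obtain ⟨v, hv⟩ := Finset.card_pos.mp this
      exact ⟨v, (Finset.mem_filter.mp hv).2⟩
    obtain ⟨a, ha⟩ := hsurj 0
    obtain ⟨b, hb⟩ := hsurj 1
    have hd := dist_le_two_of_const_on_not_adj (x := f) (G := G)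
      (fun u v huv => by rw [hf] at huv; exact not_not.mp huv)
      (show f a ≠ f b by rw [ha, hb]; decide)
    rw [distLapMatrix_multiplicities_iff hn hV hG hd, lapMatrix_two_eigenvalues_iff (by omega)]
    exact ⟨f, k, hk, (hcompl f).mpr hf, fun i => by rw [hcard]; exact ht i⟩

theorem exists_sizes_iff {n : ℕ} (hn : 6 ≤ n) (hV : Fintype.card V = n) :
    (∃ (t : Fin 4 → ℕ) (k : ℕ), 2 ≤ k ∧ (∀ i, t i = 1 ∨ t i = k) ∧ HasMultipartition G t) ↔
      (4 ∣ n ∧ HasMultipartition G ![n / 4, n / 4, n / 4, n / 4]) ∨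
      (3 ∣ (n - 1) ∧ HasMultipartition G ![(n - 1) / 3, (n - 1) / 3, (n - 1) / 3, 1]) ∨
      (2 ∣ (n - 2) ∧ HasMultipartition G ![(n - 2) / 2, (n - 2) / 2, 1, 1]) ∨
      HasMultipartition G ![n - 3, 1, 1, 1] := by
  constructor
  · rintro ⟨s, k, hk, hs, h⟩
    obtain ⟨σ, hanti, ht⟩ := h.exists_antitone
    have hval : ∀ i, (s ∘ σ) i = 1 ∨ (s ∘ σ) i = k := fun i => hs _
    generalize s ∘ σ = t at hanti ht hval
    have hsum := ht.sum_eq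
    have h01 := hanti (show (0 : Fin 4) ≤ 1 by decide)
    have h12 := hanti (show (1 : Fin 4) ≤ 2 by decide)
    have h23 := hanti (show (2 : Fin 4) ≤ 3 by decide)
    have heta : t = ![t 0, t 1, t 2, t 3] := by
      ext i
      fin_cases i <;> rfl
    have hform : ∀ {a b c d : ℕ}, t 0 = a → t 1 = b → t 2 = c → t 3 = d →
        HasMultipartition G ![a, b, c, d] := by
      rintro a b c d rfl rfl rfl rfl
      rwa [← heta]
    have h0 := hval 0
    have h1 := hval 1
    have h2 := hval 2
    have h3 := hval 3
    by_cases h3' : t 3 = k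
    · exact .inl ⟨by omega, hform (by omega) (by omega) (by omega) (by omega)⟩
    by_cases h2' : t 2 = k
    · exact .inr <| .inl ⟨by omega, hform (by omega) (by omega) (by omega) (by omega)⟩
    by_cases h1' : t 1 = k
    · exact .inr <| .inr <| .inl ⟨by omega, hform (by omega) (by omega) (by omega) (by omega)⟩
    · exact .inr <| .inr <| .inr <| hform (by omega) (by omega) (by omega) (by omega)
  · rintro (⟨hdvd, h⟩ | ⟨hdvd, h⟩ | ⟨hdvd, h⟩ | h)
    · exact ⟨_, n / 4, by omega, fun i => by fin_cases i <;> simp, h⟩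
    · exact ⟨_, (n - 1) / 3, by omega, fun i => by fin_cases i <;> simp, h⟩
    · exact ⟨_, (n - 2) / 2, by omega, fun i => by fin_cases i <;> simp, h⟩
    · exact ⟨_, n - 3, by omega, fun i => by fin_cases i <;> simp, h⟩

theorem nonempty_iso_K4parts_iff : Nonempty (G ≃g K4parts t) ↔ HasMultipartition G t :=
  ⟨fun ⟨e⟩ => (hasMultipartition_K4parts t).of_iso e,
    fun h => h.nonempty_iso (hasMultipartition_K4parts t)⟩

theorem nonempty_iso_completeSplitGraph_iff {n : ℕ} (hn : 3 ≤ n) :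
    Nonempty (G ≃g completeSplitGraph n (n - 3)) ↔ HasMultipartition G ![n - 3, 1, 1, 1] :=
  ⟨fun ⟨e⟩ => (hasMultipartition_completeSplitGraph hn).of_iso e,
    fun h => h.nonempty_iso (hasMultipartition_completeSplitGraph hn)⟩

end CompleteMultipartite

/-- For a connected graph `G` on `n ≥ 6` vertices: the largest distance Laplacian eigenvalue
has multiplicity `n - 4` and `n` is a distance Laplacian eigenvalue of multiplicity `3` iff
`G` is `K_{n/4,n/4,n/4,n/4}` (when `4 ∣ n`), `K_{(n-1)/3,(n-1)/3,(n-1)/3,1}` (when `3 ∣ n-1`),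
`K_{(n-2)/2,(n-2)/2,1,1}` (when `2 ∣ n-2`), or the complete split graph `SK_{n,n-3}`. -/
theorem stmt_10 (n : ℕ) (hn : 6 ≤ n) (G : SimpleGraph (Fin n)) (hG : G.Connected)
    (M : Matrix (Fin n) (Fin n) ℝ) (hM : M = distLapMatrix G) :
    ((∃ μ : ℝ, IsEigenvalue M μ ∧ (∀ ν : ℝ, IsEigenvalue M ν → ν ≤ μ) ∧
        eigMult M μ = n - 4) ∧ eigMult M (n : ℝ) = 3) ↔
      ((4 ∣ n ∧ Nonempty (G ≃g K4parts ![n / 4, n / 4, n / 4, n / 4])) ∨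
       (3 ∣ (n - 1) ∧
         Nonempty (G ≃g K4parts ![(n - 1) / 3, (n - 1) / 3, (n - 1) / 3, 1])) ∨
       (2 ∣ (n - 2) ∧ Nonempty (G ≃g K4parts ![(n - 2) / 2, (n - 2) / 2, 1, 1])) ∨
       Nonempty (G ≃g completeSplitGraph n (n - 3))) := by
  subst hM
  rw [distLapMatrix_multiplicities_iff_hasMultipartition hn (Fintype.card_fin n) hG,
    exists_sizes_iff hn (Fintype.card_fin n), nonempty_iso_K4parts_iff, nonempty_iso_K4parts_iff,
    nonempty_iso_K4parts_iff, nonempty_iso_completeSplitGraph_iff (by omega)]
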